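/- Fix a real constant b ≠ 0 and work on U = {(x,y,z) ∈ ℝ³ : x > 0}. With the Jacobi structure Λ^{12} = ½(1 − e^{b(y−z)}), Λ^{13} = −½(1 − e^{b(y−z)}), Λ^{23} = (y+z)·e^{b(y−z)}, E = (−b, 0, 0): (a) the Hamiltonian vector field of h = 1 − e^{−b(y−z)} equals X_h = (0, b(y+z), b(y+z)); (b) the vector fields X₁ = (−bx, ½(1 − e^{b(y−z)}), −½(1 − e^{b(y−z)})) and X₂ = (x·ln(x), −(1 − e^{b(y−z)})(1 + ln(x))/(2b), (1 − e^{b(y−z)})(1 + ln(x))/(2b)) satisfy [X₁, X₂] = X₁ on U; and (c) [X_h, X₁] = 0 and [X_h, X₂] = 0 on U, i.e., X_h is a t-independent Lie symmetry of the Lie system spanned by X₁, X₂. -/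

import Mathlib

open Real

/-- Partial derivative `∂_μ f` on `ℝ³`. -/
noncomputable def pd (μ : Fin 3) (f : (Fin 3 → ℝ) → ℝ) (p : Fin 3 → ℝ) : ℝ :=
  fderiv ℝ f p (Pi.single μ 1)

/-- The Hamiltonian vector field of `f` with respect to a bivector `Λ` and a
vector field `E` on `ℝ³`: `X_f^ν = Σ_μ (∂_μ f)·Λ^{μν} + f·E^ν`. -/
noncomputable def hamVF (Λ : (Fin 3 → ℝ) → Fin 3 → Fin 3 → ℝ)
    (E : (Fin 3 → ℝ) → Fin 3 → ℝ) (f : (Fin 3 → ℝ) → ℝ) (p : Fin 3 → ℝ) : Fin 3 → ℝ :=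
  fun ν => (∑ μ : Fin 3, pd μ f p * Λ p μ ν) + f p * E p ν

/-- The Lie bracket of vector fields on (an open subset of) `ℝ³`:
`[X,Y](p) = DY(p)(X(p)) − DX(p)(Y(p))`. -/
noncomputable def lieBr (X Y : (Fin 3 → ℝ) → (Fin 3 → ℝ)) (p : Fin 3 → ℝ) : Fin 3 → ℝ :=
  fderiv ℝ Y p (X p) - fderiv ℝ X p (Y p)

/-- The bivector with `Λ^{12} = ½(1 − e^{b(y−z)})`, `Λ^{13} = −½(1 − e^{b(y−z)})`,
`Λ^{23} = (y+z)·e^{b(y−z)}`. -/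
noncomputable def Lam (b : ℝ) : (Fin 3 → ℝ) → Fin 3 → Fin 3 → ℝ := fun p =>
  ![![0, (1 - exp (b * (p 1 - p 2))) / 2, -((1 - exp (b * (p 1 - p 2))) / 2)],
    ![-((1 - exp (b * (p 1 - p 2))) / 2), 0, (p 1 + p 2) * exp (b * (p 1 - p 2))],
    ![(1 - exp (b * (p 1 - p 2))) / 2, -((p 1 + p 2) * exp (b * (p 1 - p 2))), 0]]

/-- The Reeb vector field `E = (−b, 0, 0)`. -/
noncomputable def Evec (b : ℝ) : (Fin 3 → ℝ) → Fin 3 → ℝ := fun _ => ![-b, 0, 0]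

/-- h = 1 − e^{−b(y−z)}. -/
noncomputable def h (b : ℝ) : (Fin 3 → ℝ) → ℝ := fun q => 1 - exp (-b * (q 1 - q 2))

/-- X_h = (0, b(y+z), b(y+z)). -/
noncomputable def Xh (b : ℝ) : (Fin 3 → ℝ) → (Fin 3 → ℝ) := fun p =>
  ![0, b * (p 1 + p 2), b * (p 1 + p 2)]

/-- X₁ = (−bx, ½(1 − e^{b(y−z)}), −½(1 − e^{b(y−z)})). -/
noncomputable def X₁ (b : ℝ) : (Fin 3 → ℝ) → (Fin 3 → ℝ) := fun p =>
  ![-(b * p 0), (1 - exp (b * (p 1 - p 2))) / 2, -((1 - exp (b * (p 1 - p 2))) / 2)]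

/-- X₂ = (x·ln(x), −(1 − e^{b(y−z)})(1 + ln(x))/(2b), (1 − e^{b(y−z)})(1 + ln(x))/(2b)). -/
noncomputable def X₂ (b : ℝ) : (Fin 3 → ℝ) → (Fin 3 → ℝ) := fun p =>
  ![p 0 * Real.log (p 0),
    -((1 - exp (b * (p 1 - p 2))) * (1 + Real.log (p 0)) / (2 * b)),
    (1 - exp (b * (p 1 - p 2))) * (1 + Real.log (p 0)) / (2 * b)]

/-- A function `F : ℝ³ → ℝ³` whose three components are differentiable has the expected
directional derivatives. -/
theorem fderiv_vecCons_apply {F : (Fin 3 → ℝ) → (Fin 3 → ℝ)} {p : Fin 3 → ℝ}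
    {f₀ f₁ f₂ : (Fin 3 → ℝ) →L[ℝ] ℝ} (h₀ : HasFDerivAt (fun q => F q 0) f₀ p)
    (h₁ : HasFDerivAt (fun q => F q 1) f₁ p) (h₂ : HasFDerivAt (fun q => F q 2) f₂ p)
    (v : Fin 3 → ℝ) : fderiv ℝ F p v = ![f₀ v, f₁ v, f₂ v] := by
  have hF : HasFDerivAt F (ContinuousLinearMap.pi ![f₀, f₁, f₂]) p := by
    rw [hasFDerivAt_pi']
    intro i
    fin_cases i
    exacts [h₀, h₁, h₂]
  rw [hF.fderiv]
  ext i
  fin_cases i <;> rfl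

theorem hasFDerivAt_exp_mul_sub (c : ℝ) (p : Fin 3 → ℝ) :
    HasFDerivAt (fun q : Fin 3 → ℝ => exp (c * (q 1 - q 2)))
      (exp (c * (p 1 - p 2)) • c • (ContinuousLinearMap.proj (R := ℝ) (φ := fun _ : Fin 3 => ℝ) 1 -
        ContinuousLinearMap.proj (R := ℝ) (φ := fun _ : Fin 3 => ℝ) 2)) p :=
  (((hasFDerivAt_apply 1 p).sub (hasFDerivAt_apply 2 p)).const_mul c).exp

theorem fderiv_Xh_apply (b : ℝ) (p v : Fin 3 → ℝ) :
    fderiv ℝ (Xh b) p v = ![0, b * (v 1 + v 2), b * (v 1 + v 2)] := by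
  have hs := ((hasFDerivAt_apply (𝕜 := ℝ) (F' := fun _ : Fin 3 => ℝ) 1 p).add
    (hasFDerivAt_apply 2 p)).const_mul b
  rw [fderiv_vecCons_apply (F := Xh b) (hasFDerivAt_const 0 p) hs hs]
  simp [mul_add]

theorem fderiv_X₁_apply (b : ℝ) (p v : Fin 3 → ℝ) :
    fderiv ℝ (X₁ b) p v =
      ![-(b * v 0), -(exp (b * (p 1 - p 2)) * (b * (v 1 - v 2))) / 2,
        exp (b * (p 1 - p 2)) * (b * (v 1 - v 2)) / 2] := by
  have h₁ := ((hasFDerivAt_exp_mul_sub b p).const_sub 1).mul_const (2⁻¹ : ℝ)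
  have h₀ := ((hasFDerivAt_apply (𝕜 := ℝ) (F' := fun _ : Fin 3 => ℝ) 0 p).const_mul b).neg
  rw [fderiv_vecCons_apply (F := X₁ b) h₀ h₁ h₁.neg]
  ext i
  fin_cases i <;> simp <;> ring

theorem fderiv_X₂_apply (b : ℝ) {p : Fin 3 → ℝ} (hp : p 0 ≠ 0) (v : Fin 3 → ℝ) :
    fderiv ℝ (X₂ b) p v =
      ![(1 + Real.log (p 0)) * v 0,
        (exp (b * (p 1 - p 2)) * (b * (v 1 - v 2)) * (1 + Real.log (p 0)) -
          (1 - exp (b * (p 1 - p 2))) * (v 0 / p 0)) / (2 * b),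
        -((exp (b * (p 1 - p 2)) * (b * (v 1 - v 2)) * (1 + Real.log (p 0)) -
          (1 - exp (b * (p 1 - p 2))) * (v 0 / p 0)) / (2 * b))] := by
  have hx := hasFDerivAt_apply (𝕜 := ℝ) (F' := fun _ : Fin 3 => ℝ) 0 p
  have h₂ := (((hasFDerivAt_exp_mul_sub b p).const_sub 1).mul
    ((hx.log hp).const_add 1)).mul_const (2 * b)⁻¹
  rw [fderiv_vecCons_apply (F := X₂ b) (hx.mul (hx.log hp)) h₂.neg h₂]
  ext i
  fin_cases i <;> simp <;> field_simp <;> ring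

theorem pd_h (b : ℝ) (μ : Fin 3) (p : Fin 3 → ℝ) :
    pd μ (h b) p = ![0, b * exp (-b * (p 1 - p 2)), -(b * exp (-b * (p 1 - p 2)))] μ := by
  have hh : HasFDerivAt (h b) _ p := (hasFDerivAt_exp_mul_sub (-b) p).const_sub 1
  rw [pd, hh.fderiv]
  fin_cases μ <;> simp <;> ring

/-- For `b ≠ 0`, on `U = {(x,y,z) : x > 0}` with the Jacobi structure `(Λ, E)`
above: (a) the Hamiltonian vector field of `h = 1 − e^{−b(y−z)}` equals
`X_h = (0, b(y+z), b(y+z))`; (b) `[X₁, X₂] = X₁` on `U`; and (c)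
`[X_h, X₁] = 0` and `[X_h, X₂] = 0` on `U`, i.e. `X_h` is a t-independent Lie
symmetry of the Lie system spanned by `X₁, X₂`. -/
theorem stmt_17 (b : ℝ) (hb : b ≠ 0) (p : Fin 3 → ℝ)
    (hp : p ∈ {q : Fin 3 → ℝ | 0 < q 0}) :
    hamVF (Lam b) (Evec b) (h b) p = Xh b p ∧
    lieBr (X₁ b) (X₂ b) p = X₁ b p ∧
    lieBr (Xh b) (X₁ b) p = 0 ∧
    lieBr (Xh b) (X₂ b) p = 0 := by
  have hx : p 0 ≠ 0 := ne_of_gt hp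
  refine ⟨?_, ?_, ?_, ?_⟩
  · have he : exp (-b * (p 1 - p 2)) * exp (b * (p 1 - p 2)) = 1 := by
      rw [← Real.exp_add]
      simp
    ext ν
    simp only [hamVF, pd_h, Fin.sum_univ_three]
    fin_cases ν <;> simp only [Lam, Evec, Xh, h] <;> simp <;> simp only [neg_mul] at he
    · linear_combination b * he
    · linear_combination b * (p 1 + p 2) * he
    · linear_combination b * (p 1 + p 2) * he
  · rw [lieBr, fderiv_X₁_apply, fderiv_X₂_apply b hx]
    ext i
    fin_cases i <;> simp [X₁, X₂] <;> field_simp <;> ring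
  · rw [lieBr, fderiv_X₁_apply, fderiv_Xh_apply]
    ext i
    fin_cases i <;> simp [X₁, Xh]
  · rw [lieBr, fderiv_X₂_apply b hx, fderiv_Xh_apply]
    ext i
    fin_cases i <;> simp [X₂, Xh]
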